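/- arXiv:1711.07737 — 2 statements merged into one kernel-verified Lean document; each statement's English description precedes it below -/
import Mathlib

section
/- Let H be a countable group acting on a measure space (S,ν) by measurable, measure-preserving bijections, and suppose S is partitioned into measurable subsets S = ⨆_{h∈H} S_h satisfying g(S_h) = S_{gh} for all g,h ∈ H. Suppose there exists a sequence (F_n) of unit vectors in L²(S,ν) such that ‖g·F_n − F_n‖₂ → 0 for every g ∈ H, where g·F := F ∘ g^{-1}. Then the functions f_n ∈ ℓ²(H) defined by f_n(h) := ‖F_n · 1_{S_h}‖₂ are unit vectors satisfying ‖λ(g)f_n − f_n‖₂ → 0 for every g ∈ H, where λ denotes the left regular representation (λ(g)f)(h) := f(g^{-1}h). In particular, the left regular representation of H on ℓ²(H) admits a sequence of almost-invariant unit vectors. -/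
open MeasureTheory Set Filter

/-- The squared `L²` norms of the restrictions of `G` to the pieces of a countable measurable
partition sum to the squared `L²` norm of `G`. -/
theorem hasSum_sq_eLpNorm_indicator {S ι : Type*} [MeasurableSpace S] {ν : Measure S}
    [Countable ι] {P : ι → Set S} (hP : ∀ i, MeasurableSet (P i))
    (hd : Pairwise (Function.onFun Disjoint P)) (hc : (⋃ i, P i) = Set.univ)
    {G : S → ℝ} (hG : MemLp G 2 ν) :
    HasSum (fun i => (eLpNorm ((P i).indicator G) 2 ν).toReal ^ 2)
      ((eLpNorm G 2 ν).toReal ^ 2) := by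
  have sq_eq (μ : Measure S) : eLpNorm G 2 μ ^ 2 = ∫⁻ x, ‖G x‖ₑ ^ 2 ∂μ := by
    have h := eLpNorm_nnreal_pow_eq_lintegral (f := G) (μ := μ) (p := 2) (by norm_num)
    simpa using h
  have key : ∑' i, eLpNorm ((P i).indicator G) 2 ν ^ 2 = eLpNorm G 2 ν ^ 2 := by
    simp_rw [eLpNorm_indicator_eq_eLpNorm_restrict (hP _), sq_eq]
    rw [← lintegral_iUnion hP hd, hc, Measure.restrict_univ]
  have hne : ∑' i, eLpNorm ((P i).indicator G) 2 ν ^ 2 ≠ ⊤ := by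
    rw [key]
    exact ENNReal.pow_ne_top hG.eLpNorm_ne_top
  have h := ENNReal.hasSum_toReal hne
  rw [← ENNReal.tsum_toReal_eq (fun i => ENNReal.ne_top_of_tsum_ne_top hne i), key] at h
  simpa only [ENNReal.toReal_pow] using h

/-- Reverse triangle inequality for the `L²` norm of functions. -/
theorem abs_toReal_eLpNorm_sub_le {S : Type*} [MeasurableSpace S] {ν : Measure S}
    {A B : S → ℝ} (hA : MemLp A 2 ν) (hB : MemLp B 2 ν) :
    |(eLpNorm A 2 ν).toReal - (eLpNorm B 2 ν).toReal| ≤ (eLpNorm (A - B) 2 ν).toReal := by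
  have h := abs_norm_sub_norm_le (hA.toLp A) (hB.toLp B)
  rwa [← MemLp.toLp_sub, Lp.norm_toLp, Lp.norm_toLp, Lp.norm_toLp] at h

/-- Let a countable group `H` act on a measure space `(S,ν)`
by measurable, measure-preserving bijections, with a measurable partition
`S = ⨆_{h∈H} S_h` satisfying `g(S_h) = S_{gh}`.  If `(F_n)` is a sequence of
almost-invariant unit vectors in `L²(S,ν)`, then the functions
`f_n(h) := ‖F_n · 1_{S_h}‖₂` are almost-invariant unit vectors for the left
regular representation of `H` on `ℓ²(H)`. -/
theorem almost_invariant_vectors_for_regular_representation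
    {S H : Type*} [MeasurableSpace S] (ν : Measure S)
    [Group H] [Countable H] [MulAction H S]
    (hact : ∀ g : H, MeasurePreserving (fun s : S => g • s) ν ν)
    (Spart : H → Set S)
    (hSmeas : ∀ h : H, MeasurableSet (Spart h))
    (hSdisj : ∀ h h' : H, h ≠ h' → Disjoint (Spart h) (Spart h'))
    (hScover : (⋃ h : H, Spart h) = Set.univ)
    (hSequiv : ∀ g h : H, (fun s : S => g • s) '' Spart h = Spart (g * h))
    (F : ℕ → S → ℝ)
    (hF2 : ∀ n, MemLp (F n) 2 ν)
    (hFnorm : ∀ n, eLpNorm (F n) 2 ν = 1)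
    (hFai : ∀ g : H,
      Tendsto (fun n => eLpNorm (fun s : S => F n (g⁻¹ • s) - F n s) 2 ν)
        atTop (nhds 0))
    (f : ℕ → H → ℝ)
    (hf : ∀ n h, f n h = (eLpNorm ((Spart h).indicator (F n)) 2 ν).toReal) :
    (∀ n, ∑' h : H, (f n h) ^ 2 = 1) ∧
    ∀ g : H,
      Tendsto (fun n => Real.sqrt (∑' h : H, (f n (g⁻¹ * h) - f n h) ^ 2))
        atTop (nhds 0) := by
  have hd : Pairwise (Function.onFun Disjoint Spart) := fun h h' hne => hSdisj h h' hne
  refine ⟨fun n => ?_, fun g => ?_⟩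
  · simp_rw [hf]
    rw [(hasSum_sq_eLpNorm_indicator hSmeas hd hScover (hF2 n)).tsum_eq, hFnorm n]
    simp
  · have hmem (n : ℕ) : MemLp (fun s => F n (g⁻¹ • s)) 2 ν :=
      (hF2 n).comp_measurePreserving (hact g⁻¹)
    have htrans (n : ℕ) (h : H) : f n (g⁻¹ * h) =
        (eLpNorm ((Spart h).indicator (fun s => F n (g⁻¹ • s))) 2 ν).toReal := by
      rw [hf, ← eLpNorm_comp_measurePreserving
        ((hF2 n).indicator (hSmeas _)).aestronglyMeasurable (hact g⁻¹)]
      congr 2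
      ext s
      have hs : g⁻¹ • s ∈ Spart (g⁻¹ * h) ↔ s ∈ Spart h := by
        rw [← hSequiv]
        exact (MulAction.injective g⁻¹).mem_set_image
      by_cases hsh : s ∈ Spart h
      · simp [hsh, hs.2 hsh]
      · simp [hsh, mt hs.1 hsh]
    have hle (n : ℕ) (h : H) : (f n (g⁻¹ * h) - f n h) ^ 2 ≤
        (eLpNorm ((Spart h).indicator ((fun s => F n (g⁻¹ • s)) - F n)) 2 ν).toReal ^ 2 := by
      rw [htrans, hf, Set.indicator_sub']
      exact sq_le_sq.2 ((abs_toReal_eLpNorm_sub_le ((hmem n).indicator (hSmeas h))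
        ((hF2 n).indicator (hSmeas h))).trans (le_abs_self _))
    have hlim : Tendsto (fun n => (eLpNorm ((fun s => F n (g⁻¹ • s)) - F n) 2 ν).toReal)
        atTop (nhds 0) :=
      (ENNReal.tendsto_toReal ENNReal.zero_ne_top).comp (hFai g)
    refine squeeze_zero (fun n => Real.sqrt_nonneg _) (fun n => ?_) hlim
    have hs := hasSum_sq_eLpNorm_indicator hSmeas hd hScover ((hmem n).sub (hF2 n))
    refine Real.sqrt_le_iff.2 ⟨ENNReal.toReal_nonneg, ?_⟩
    rw [← hs.tsum_eq]
    exact (hs.summable.of_nonneg_of_le (fun h => sq_nonneg _) (hle n)).tsum_le_tsum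
      (hle n) hs.summable
end

section
/- Let G be a topological group, H ≤ G an open subgroup of finite index, π a strongly continuous unitary representation of G on a Hilbert space 𝓚, and b : G → 𝓚 a continuous 1-cocycle. If the restriction of b to H is an almost coboundary for the restricted representation π|_H, then b is an almost coboundary for π. (Equivalently, the restriction map on reduced first continuous cohomology H̄¹_c(G,π) → H̄¹_c(H,π|_H) is injective.) -/
open Set

/-- Let `G` be a topological group, `H ≤ G` an open subgroup
of finite index, `π` a strongly continuous unitary representation of `G` on a
Hilbert space `K`, and `b : G → K` a continuous 1-cocycle.  If the restriction
of `b` to `H` is an almost coboundary (for the restricted representation), then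
`b` is an almost coboundary.  Equivalently, the restriction map
`H̄¹_c(G,π) → H̄¹_c(H,π|_H)` on reduced continuous cohomology is injective. -/
theorem almost_coboundary_of_restriction_to_open_finite_index_subgroup
    {G 𝕜 K : Type*} [TopologicalSpace G] [Group G] [IsTopologicalGroup G]
    [RCLike 𝕜] [NormedAddCommGroup K] [InnerProductSpace 𝕜 K] [CompleteSpace K]
    (π : G → K ≃ₗᵢ[𝕜] K)
    (hπmul : ∀ g h : G, ∀ v : K, π (g * h) v = π g (π h v))
    (hπcont : ∀ v : K, Continuous fun g : G => π g v)
    (b : G → K) (hb : Continuous b)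
    (hcoc : ∀ g h : G, b (g * h) = b g + π g (b h))
    (H : Subgroup G) (hHopen : IsOpen (H : Set G)) (hHfin : H.index ≠ 0)
    (hrestr : ∀ ε : ℝ, 0 < ε → ∀ Q : Set G, IsCompact Q → Q ⊆ (H : Set G) →
      ∃ v : K, ∀ g ∈ Q, ‖b g - (π g v - v)‖ < ε) :
    ∀ ε : ℝ, 0 < ε → ∀ Q : Set G, IsCompact Q →
      ∃ v : K, ∀ g ∈ Q, ‖b g - (π g v - v)‖ < ε := by
  intro ε hε Q hQ
  have : Fintype (G ⧸ H) := H.fintypeOfIndexNeZero hHfin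
  let s : G ⧸ H → G := Quotient.out
  have hs : ∀ x : G ⧸ H, (s x : G ⧸ H) = x := fun x => Quotient.out_eq' x
  let Q' : Set G := (⋃ p : (G ⧸ H) × (G ⧸ H), (fun g => (s p.1)⁻¹ * g * s p.2) '' Q) ∩ H
  have hQ' : IsCompact Q' :=
    (isCompact_iUnion fun p => hQ.image (by fun_prop)).inter_right (H.isClosed_of_isOpen hHopen)
  obtain ⟨v, hv⟩ := hrestr ε hε Q' hQ' inter_subset_right
  -- The affine isometric action attached to `b`; `-v` is almost fixed by `H`.
  let A : G → K → K := fun g u => b g + π g u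
  have hAmul (g h : G) (u : K) : A (g * h) u = A g (A h u) := by
    simp only [A, hcoc, hπmul, map_add, add_assoc]
  have hAnorm (g : G) (u u' : K) : ‖A g u - A g u'‖ = ‖u - u'‖ := by
    simp only [A, add_sub_add_left_eq_sub, ← map_sub, LinearIsometryEquiv.norm_map]
  have hfix (g : G) (u : K) : b g - (π g u - u) = A g (-u) - -u := by
    simp only [A, map_neg]; abel
  have hcard : (Fintype.card (G ⧸ H) : 𝕜) ≠ 0 := Nat.cast_ne_zero.mpr Fintype.card_ne_zero
  have hpos : (0 : ℝ) < Fintype.card (G ⧸ H) := Nat.cast_pos.mpr Fintype.card_pos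
  let S : K := ∑ x, A (s x) (-v)
  let w : K := (Fintype.card (G ⧸ H) : 𝕜)⁻¹ • S
  have hw : (Fintype.card (G ⧸ H) : 𝕜) • w = S := smul_inv_smul₀ hcard S
  refine ⟨-w, fun g hg => ?_⟩
  rw [hfix, neg_neg]
  have hterm (x : G ⧸ H) : ‖A (g * s x) (-v) - A (s (g • x)) (-v)‖ < ε := by
    have hmem : (s (g • x))⁻¹ * g * s x ∈ H := by
      rw [mul_assoc, ← QuotientGroup.eq, hs, ← smul_eq_mul, MulAction.Quotient.coe_smul_out]
    have hlt := hv _ ⟨mem_iUnion.mpr ⟨(g • x, x), mem_image_of_mem _ hg⟩, hmem⟩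
    rw [hfix, ← hAnorm (s (g • x)), ← hAmul] at hlt
    simpa only [mul_assoc, mul_inv_cancel_left] using hlt
  have hsum : (Fintype.card (G ⧸ H) : 𝕜) • (A g w - w) =
      ∑ x, (A (g * s x) (-v) - A (s (g • x)) (-v)) := by
    have hperm : ∑ x, A (s (g • x)) (-v) = S :=
      Equiv.sum_comp (MulAction.toPerm g) fun x => A (s x) (-v)
    rw [Finset.sum_sub_distrib, hperm, smul_sub, hw]
    simp only [hAmul]
    simp only [A, smul_add, ← map_smul, hw]
    simp [S, A, Finset.sum_add_distrib, Nat.cast_smul_eq_nsmul]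
  refine lt_of_mul_lt_mul_left ?_ hpos.le
  calc (Fintype.card (G ⧸ H) : ℝ) * ‖A g w - w‖
      = ‖∑ x, (A (g * s x) (-v) - A (s (g • x)) (-v))‖ := by
        rw [← hsum, norm_smul, RCLike.norm_natCast]
    _ ≤ ∑ x, ‖A (g * s x) (-v) - A (s (g • x)) (-v)‖ := norm_sum_le _ _
    _ < ∑ _x : G ⧸ H, ε :=
        Finset.sum_lt_sum_of_nonempty Finset.univ_nonempty fun x _ => hterm x
    _ = Fintype.card (G ⧸ H) * ε := by simp
end
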